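/- arXiv:1101.4883 — 3 statements merged into one kernel-verified Lean document; each statement's English description precedes it below -/
import Mathlib

section
/- Let P, L, F, M, W, A, C be finite-dimensional vector spaces over ℚ and let ∂ : P → L, j : L → F, a : L → M, b : F → W, α : A → F, β : F → C, T : F → F be linear maps such that: j is injective; range ∂ = ker a; range (j ∘ ∂) = ker b; the sequence 0 → A →α F →^{T−id} F →β C → 0 is exact (α injective, range α = ker(T − id), range (T − id) = ker β, β surjective); and finrank A = finrank L. Then rank a = rank b if and only if T is the identity map of F. -/
open Module

/-- Assembled linear-algebra content of the proof of the Stability Theorem for n ≥ 2: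
with `j` injective, `range ∂ = ker a`, `range (j ∘ ∂) = ker b`, an exact sequence
`0 → A →α F →(T−id) F →β C → 0`, and `finrank A = finrank L`, one has
`rank a = rank b` iff `T` is the identity. -/
theorem stability_monodromy_core
    (P L F M W A C : Type*)
    [AddCommGroup P] [Module ℚ P] [FiniteDimensional ℚ P]
    [AddCommGroup L] [Module ℚ L] [FiniteDimensional ℚ L]
    [AddCommGroup F] [Module ℚ F] [FiniteDimensional ℚ F]
    [AddCommGroup M] [Module ℚ M] [FiniteDimensional ℚ M]
    [AddCommGroup W] [Module ℚ W] [FiniteDimensional ℚ W]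
    [AddCommGroup A] [Module ℚ A] [FiniteDimensional ℚ A]
    [AddCommGroup C] [Module ℚ C] [FiniteDimensional ℚ C]
    (d : P →ₗ[ℚ] L) (j : L →ₗ[ℚ] F) (a : L →ₗ[ℚ] M) (b : F →ₗ[ℚ] W)
    (α : A →ₗ[ℚ] F) (β : F →ₗ[ℚ] C) (T : F →ₗ[ℚ] F)
    (hj : Function.Injective j)
    (hda : LinearMap.range d = LinearMap.ker a)
    (hjb : LinearMap.range (j ∘ₗ d) = LinearMap.ker b)
    (hα : Function.Injective α)
    (hαT : LinearMap.range α = LinearMap.ker (T - LinearMap.id))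
    (hTβ : LinearMap.range (T - LinearMap.id) = LinearMap.ker β)
    (hβ : Function.Surjective β)
    (hAL : finrank ℚ A = finrank ℚ L) :
    finrank ℚ (LinearMap.range a) = finrank ℚ (LinearMap.range b) ↔
      T = LinearMap.id := by
  have hd : finrank ℚ (LinearMap.ker a) = finrank ℚ (LinearMap.ker b) := by
    rw [← hda, ← hjb, LinearMap.range_comp]
    exact (Submodule.equivMapOfInjective j hj (LinearMap.range d)).finrank_eq
  have hA : finrank ℚ (LinearMap.ker (T - LinearMap.id)) = finrank ℚ L := by
    rw [← hαT, LinearMap.finrank_range_of_inj hα, hAL]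
  have ha := a.finrank_range_add_finrank_ker
  have hb := b.finrank_range_add_finrank_ker
  rw [← sub_eq_zero (a := T), ← LinearMap.ker_eq_top]
  constructor
  · intro h
    exact Submodule.eq_top_of_finrank_eq (by omega)
  · intro h
    rw [h, finrank_top] at hA
    omega
end

section
/- Let z : Fin 5 → ℂ satisfy z 0 = 1 and the gradient equations (z i)^4 = ∏_{j ≠ i} (z j) for every i ∈ Fin 5. Then (z i)^5 = 1 for every i ∈ Fin 5, z 1 · z 2 · z 3 · z 4 = 1 (so z 1 = (z 2 · z 3 · z 4)⁻¹), and moreover ∑_{i} (z i)^5 = 5 · ∏_{i} (z i), i.e. the point lies on the singular quintic V₀. -/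
open Finset

/-- A normalized critical point of the Fermat-type quintic (with `z 0 = 1`) has all
coordinates fifth roots of unity, satisfies `z 1 · z 2 · z 3 · z 4 = 1`, and lies on
the singular quintic `∑ zᵢ⁵ = 5 ∏ zᵢ`. -/
theorem quintic_gradient_normalized
    (z : Fin 5 → ℂ) (h0 : z 0 = 1)
    (hgrad : ∀ i : Fin 5, (z i) ^ 4 = ∏ j ∈ univ.erase i, z j) :
    (∀ i : Fin 5, (z i) ^ 5 = 1) ∧
    (z 1 * z 2 * z 3 * z 4 = 1 ∧ z 1 = (z 2 * z 3 * z 4)⁻¹) ∧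
    (∑ i : Fin 5, (z i) ^ 5 = 5 * ∏ i : Fin 5, z i) := by
  have pow_five_eq_prod (i : Fin 5) : z i ^ 5 = ∏ j, z j := by
    rw [pow_succ', hgrad i, mul_prod_erase univ z (mem_univ i)]
  have prod_eq_one : ∏ j, z j = 1 := by rw [← pow_five_eq_prod 0, h0, one_pow]
  have pow_five_eq_one (i : Fin 5) : z i ^ 5 = 1 := (pow_five_eq_prod i).trans prod_eq_one
  have prod_tail : z 1 * z 2 * z 3 * z 4 = 1 := by
    simpa [Fin.prod_univ_five, h0] using prod_eq_one
  refine ⟨pow_five_eq_one, ⟨prod_tail, eq_inv_of_mul_eq_one_left ?_⟩, ?_⟩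
  · simpa only [mul_assoc] using prod_tail
  · simp [pow_five_eq_one, prod_eq_one]
end

section
/- Let ω, ξ, η ∈ ℂ with ω⁵ = ξ⁵ = η⁵ = 1, and let z : Fin 5 → ℂ be the point z = (1, (ωξη)⁻¹, ω, ξ, η). Then z satisfies the gradient equations (z i)^4 = ∏_{j ≠ i} (z j) for every i ∈ Fin 5, and ∑_{i} (z i)^5 = 5 · ∏_{i} (z i), i.e. z lies on the singular quintic V₀. -/
open Finset

/-- For any triple (ω, ξ, η) of fifth roots of unity, the point
`(1, (ωξη)⁻¹, ω, ξ, η)` satisfies the gradient equations of the Fermat-type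
quintic and lies on the singular quintic `V₀`. -/
theorem quintic_singularities
    (ω ξ η : ℂ) (hω : ω ^ 5 = 1) (hξ : ξ ^ 5 = 1) (hη : η ^ 5 = 1) :
    let z : Fin 5 → ℂ := ![1, (ω * ξ * η)⁻¹, ω, ξ, η]
    (∀ i : Fin 5, (z i) ^ 4 = ∏ j ∈ univ.erase i, z j) ∧
    (∑ i : Fin 5, (z i) ^ 5 = 5 * ∏ i : Fin 5, z i) := by
  intro z
  have ne_zero_of_pow {x : ℂ} (hx : x ^ 5 = 1) : x ≠ 0 := by
    rintro rfl
    norm_num at hx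
  have hprod : ∏ i, z i = 1 := by
    have := ne_zero_of_pow hω
    have := ne_zero_of_pow hξ
    have := ne_zero_of_pow hη
    simp only [z, Fin.prod_univ_five, Matrix.cons_val]
    field_simp
  have hpow (i : Fin 5) : z i ^ 5 = 1 := by
    fin_cases i <;> simp [z, mul_pow, inv_pow, hω, hξ, hη]
  refine ⟨fun i => mul_right_cancel₀ (ne_zero_of_pow (hpow i)) ?_, by simp [hpow, hprod]⟩
  rw [prod_erase_mul _ _ (mem_univ i), hprod, ← pow_succ, hpow]
end
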